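/- (Heisenberg–Pauli–Weyl type uncertainty principle for the p-Laplacian) Let n ≥ 2, 1 < p < n, and let q satisfy 1/p + 1/q = 1. Let f ∈ C_0^∞(ℝⁿ \ {0}) be real-valued and assume the vector field x ↦ |∇f(x)|^{p−2} ∇f(x) is continuously differentiable, so that Δ_p f = div(|∇f|^{p−2}∇f) is defined. Then ∫_{ℝⁿ} |∇f(x)|^p dx ≤ (p/(n−p)) · (∫_{ℝⁿ} |Δ_p f(x)|^p dx)^{1/p} · (∫_{ℝⁿ} ‖x‖^q |∇f(x)|^q dx)^{1/q}. -/

import Mathlib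

open MeasureTheory

/-- Divergence of a vector field on `ℝⁿ`, given by the sum of coordinate partial derivatives. -/
noncomputable def vdiv {n : ℕ} (V : EuclideanSpace ℝ (Fin n) → EuclideanSpace ℝ (Fin n))
    (x : EuclideanSpace ℝ (Fin n)) : ℝ :=
  ∑ i, fderiv ℝ V x (EuclideanSpace.single i 1) i

/-- The vector field `|∇f|^{p-2} ∇f` associated to the `p`-Laplacian. -/
noncomputable def pLapField {n : ℕ} (p : ℝ) (f : EuclideanSpace ℝ (Fin n) → ℝ)
    (x : EuclideanSpace ℝ (Fin n)) : EuclideanSpace ℝ (Fin n) :=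
  ‖gradient f x‖ ^ (p - 2) • gradient f x

/-- The `p`-Laplacian `Δ_p f = div(|∇f|^{p-2}∇f)`. -/
noncomputable def pLaplacian {n : ℕ} (p : ℝ) (f : EuclideanSpace ℝ (Fin n) → ℝ)
    (x : EuclideanSpace ℝ (Fin n)) : ℝ :=
  vdiv (pLapField p f) x

open InnerProductSpace

/-- The integral of the divergence of a compactly supported `C¹` vector field vanishes. -/
lemma integral_vdiv_eq_zero {n : ℕ} {V : EuclideanSpace ℝ (Fin n) → EuclideanSpace ℝ (Fin n)}
    (hV : ContDiff ℝ 1 V) (hc : HasCompactSupport V) : ∫ x, vdiv V x = 0 := by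
  have hint : ∀ v, Integrable (fun x => fderiv ℝ V x v) := fun v =>
    ((hV.continuous_fderiv one_ne_zero).clm_apply continuous_const).integrable_of_hasCompactSupport
      (hc.fderiv_apply ℝ v)
  have hzero : ∀ v, ∫ x, fderiv ℝ V x v = 0 := fun v => by
    have h := integral_bilinear_fderiv_right_eq_neg_left_of_integrable (μ := volume)
      (f := fun _ => (1 : ℝ)) (g := V) (v := v) (B := ContinuousLinearMap.lsmul ℝ ℝ)
      (by simp) (by simpa using hint v)
      (by simpa using hV.continuous.integrable_of_hasCompactSupport hc)
      (fun x _ => differentiableAt_const _) (fun x _ => hV.differentiable one_ne_zero x)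
    simpa using h
  have hcoord : ∀ (i : Fin n) (v : EuclideanSpace ℝ (Fin n)),
      Integrable (fun x => fderiv ℝ V x v i) := fun i v =>
    (EuclideanSpace.proj (𝕜 := ℝ) i).integrable_comp (hint v)
  simp only [vdiv]
  rw [integral_finsetSum _ fun i _ => hcoord i _]
  refine Finset.sum_eq_zero fun i _ => ?_
  have h := (EuclideanSpace.proj (𝕜 := ℝ) i).integral_comp_comm
    (hint (EuclideanSpace.single i 1))
  rw [hzero] at h
  simpa using h

lemma continuous_vdiv {n : ℕ} {V : EuclideanSpace ℝ (Fin n) → EuclideanSpace ℝ (Fin n)}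
    (hV : ContDiff ℝ 1 V) : Continuous (vdiv V) := by
  unfold vdiv
  refine continuous_finsetSum _ fun i _ => ?_
  exact (EuclideanSpace.proj (𝕜 := ℝ) i).continuous.comp
    ((hV.continuous_fderiv one_ne_zero).clm_apply continuous_const)

lemma HasCompactSupport.vdiv {n : ℕ}
    {V : EuclideanSpace ℝ (Fin n) → EuclideanSpace ℝ (Fin n)}
    (hc : HasCompactSupport V) : HasCompactSupport (vdiv V) :=
  (hc.fderiv ℝ).mono fun x hx h => hx (by simp [_root_.vdiv, h])

lemma vdiv_smul {n : ℕ} {a : EuclideanSpace ℝ (Fin n) → ℝ}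
    {V : EuclideanSpace ℝ (Fin n) → EuclideanSpace ℝ (Fin n)} {x : EuclideanSpace ℝ (Fin n)}
    (ha : DifferentiableAt ℝ a x) (hV : DifferentiableAt ℝ V x) :
    vdiv (fun y => a y • V y) x = a x * vdiv V x + fderiv ℝ a x (V x) := by
  have hsum : V x = ∑ i, V x i • EuclideanSpace.single i (1 : ℝ) := by
    ext j
    simp [Finset.sum_apply, Pi.single_apply]
  conv_rhs => rw [hsum]
  simp only [vdiv, fderiv_fun_smul ha hV, map_sum, map_smul, Finset.mul_sum,
    ← Finset.sum_add_distrib]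
  refine Finset.sum_congr rfl fun i _ => ?_
  simp [mul_comm]

lemma vdiv_sub {n : ℕ} {V W : EuclideanSpace ℝ (Fin n) → EuclideanSpace ℝ (Fin n)}
    {x : EuclideanSpace ℝ (Fin n)} (hV : DifferentiableAt ℝ V x) (hW : DifferentiableAt ℝ W x) :
    vdiv (fun y => V y - W y) x = vdiv V x - vdiv W x := by
  simp [vdiv, fderiv_fun_sub hV hW]

lemma vdiv_id {n : ℕ} (x : EuclideanSpace ℝ (Fin n)) : vdiv (fun y => y) x = n := by
  simp [vdiv]

lemma contDiff_gradient {n : ℕ} {f : EuclideanSpace ℝ (Fin n) → ℝ} (hf : ContDiff ℝ 2 f) :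
    ContDiff ℝ 1 (gradient f) :=
  (toDual ℝ (EuclideanSpace ℝ (Fin n))).symm.contDiff.comp
    (hf.fderiv_right (m := 1) (by norm_num))

lemma HasCompactSupport.gradient {n : ℕ} {f : EuclideanSpace ℝ (Fin n) → ℝ}
    (hf : HasCompactSupport f) : HasCompactSupport (gradient f) :=
  (hf.fderiv ℝ).mono fun x hx h => hx (by simp [_root_.gradient, h])

/-- The derivative of the gradient is a symmetric operator. -/
lemma inner_fderiv_gradient_comm {n : ℕ} {f : EuclideanSpace ℝ (Fin n) → ℝ}
    (hf : ContDiff ℝ 2 f) (x v w : EuclideanSpace ℝ (Fin n)) :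
    inner ℝ (fderiv ℝ (gradient f) x v) w = inner ℝ v (fderiv ℝ (gradient f) x w) := by
  have key : ∀ v w, inner ℝ (fderiv ℝ (gradient f) x v) w = fderiv ℝ (fderiv ℝ f) x v w := by
    intro v w
    have hd : DifferentiableAt ℝ (fderiv ℝ f) x :=
      (hf.fderiv_right (m := 1) (by norm_num)).differentiable one_ne_zero x
    have h : HasFDerivAt (gradient f) _ x :=
      (toDual ℝ (EuclideanSpace ℝ (Fin n))).symm.toContinuousLinearEquiv.hasFDerivAt.comp x
        hd.hasFDerivAt
    rw [h.fderiv]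
    simp
  rw [real_inner_comm _ v, key, key]
  exact hf.contDiffAt.isSymmSndFDerivAt (by simp) v w

/-- The Pohozaev identity for the `p`-Laplacian, in pointwise divergence form. -/
lemma vdiv_pohozaev {n : ℕ} {p : ℝ} (hp : 1 < p) {f : EuclideanSpace ℝ (Fin n) → ℝ}
    (hf : ContDiff ℝ 2 f) {x : EuclideanSpace ℝ (Fin n)}
    (hV : DifferentiableAt ℝ (pLapField p f) x) :
    vdiv (fun y => (inner ℝ y (gradient f y) : ℝ) • pLapField p f y -
        (p⁻¹ * ‖gradient f y‖ ^ p) • y) x =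
      inner ℝ x (gradient f x) * pLaplacian p f x - ((n - p) / p) * ‖gradient f x‖ ^ p := by
  have hG : Differentiable ℝ (gradient f) := (contDiff_gradient hf).differentiable one_ne_zero
  have ha : DifferentiableAt ℝ (fun y => (inner ℝ y (gradient f y) : ℝ)) x :=
    differentiableAt_fun_id.inner ℝ (hG x)
  have hN : DifferentiableAt ℝ (fun y => ‖gradient f y‖ ^ p) x :=
    (hasFDerivAt_norm_rpow _ hp).differentiableAt.comp x (hG x)
  have hb : DifferentiableAt ℝ (fun y => p⁻¹ * ‖gradient f y‖ ^ p) x := hN.const_mul _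
  rw [vdiv_sub (ha.fun_smul hV) (hb.fun_smul differentiableAt_fun_id), vdiv_smul ha hV,
    vdiv_smul hb differentiableAt_fun_id, vdiv_id, fderiv_const_mul hN, hG.fderiv_norm_rpow hp,
    fderiv_inner_apply ℝ differentiableAt_fun_id (hG x)]
  have hpow : ‖gradient f x‖ ^ (p - 2) * ‖gradient f x‖ ^ 2 = ‖gradient f x‖ ^ p := by
    rcases (norm_nonneg (gradient f x)).eq_or_lt with h | h
    · rw [← h, Real.zero_rpow (by linarith : p ≠ 0)]
      simp
    · rw [← Real.rpow_natCast, ← Real.rpow_add h]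
      norm_num
  have hsymm := inner_fderiv_gradient_comm hf x x (gradient f x)
  have hp0 : p ≠ 0 := by linarith
  simp only [pLaplacian, pLapField, fderiv_fun_id, ContinuousLinearMap.id_apply, map_smul,
    real_inner_smul_left, real_inner_smul_right, real_inner_self_eq_norm_sq,
    _root_.smul_apply, ContinuousLinearMap.comp_apply, innerSL_apply_apply,
    smul_eq_mul]
  rw [← hsymm, real_inner_comm (gradient f x) (fderiv ℝ (gradient f) x x), hpow]
  field_simp
  ring

/-- Heisenberg–Pauli–Weyl type uncertainty principle for the `p`-Laplacian on `ℝⁿ`. -/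
theorem stmt15 (n : ℕ) (hn : 2 ≤ n) (p q : ℝ) (hp1 : 1 < p) (hpn : p < n)
    (hq : 1 / p + 1 / q = 1)
    (f : EuclideanSpace ℝ (Fin n) → ℝ) (hf : ContDiff ℝ (⊤ : ℕ∞) f)
    (hfc : HasCompactSupport f) (hfs : tsupport f ⊆ {(0 : EuclideanSpace ℝ (Fin n))}ᶜ)
    (hV : ContDiff ℝ 1 (pLapField p f)) :
    ∫ x, ‖gradient f x‖ ^ p
      ≤ (p / ((n : ℝ) - p)) * (∫ x, |pLaplacian p f x| ^ p) ^ (1 / p) *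
        (∫ x, ‖x‖ ^ q * ‖gradient f x‖ ^ q) ^ (1 / q) := by
  have hf2 : ContDiff ℝ 2 f := hf.of_le (WithTop.coe_le_coe.2 (le_top (a := (2 : ℕ∞))))
  have hG := contDiff_gradient hf2
  have hGc := hfc.gradient
  have hGcont := hG.continuous
  have hp0 : 0 < p := by linarith
  have hVc : HasCompactSupport (pLapField p f) :=
    hGc.mono fun x hx h => hx (by simp [pLapField, h])
  have hLcont : Continuous (pLaplacian p f) := continuous_vdiv hV
  have hLc : HasCompactSupport (pLaplacian p f) := hVc.vdiv
  have hpq : p.HolderConjugate q :=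
    (Real.holderConjugate_iff).2 ⟨hp1, by simpa only [one_div] using hq⟩
  have hNcont : Continuous fun x => ‖gradient f x‖ ^ p :=
    hGcont.norm.rpow_const fun _ => Or.inr hp0.le
  have hNc : HasCompactSupport fun x => ‖gradient f x‖ ^ p :=
    hGc.mono fun x hx h => hx (by simp [h, hp0.ne'])
  have hNint := hNcont.integrable_of_hasCompactSupport hNc (μ := volume)
  have hAcont : Continuous fun x => (inner ℝ x (gradient f x) : ℝ) * pLaplacian p f x :=
    (continuous_id.inner hGcont).mul hLcont
  have hAint := hAcont.integrable_of_hasCompactSupport (μ := volume) hLc.mul_left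
  have hpoh : ((n - p) / p) * ∫ x, ‖gradient f x‖ ^ p =
      ∫ x, (inner ℝ x (gradient f x) : ℝ) * pLaplacian p f x := by
    have h := integral_vdiv_eq_zero (V := fun y => (inner ℝ y (gradient f y) : ℝ) •
        pLapField p f y - (p⁻¹ * ‖gradient f y‖ ^ p) • y)
      (((contDiff_id.inner ℝ hG).smul hV).sub
        ((contDiff_const.mul (hG.norm_rpow hp1)).smul contDiff_id))
      (hGc.mono fun x hx h => hx (by simp [pLapField, h, hp0.ne']))
    simp only [vdiv_pohozaev hp1 hf2 (hV.differentiable one_ne_zero _)] at h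
    rw [integral_sub hAint (hNint.const_mul _), integral_const_mul] at h
    linarith
  have hBcont : Continuous fun x => ‖x‖ * ‖gradient f x‖ := continuous_norm.mul hGcont.norm
  have hCauchy : ∫ x, (inner ℝ x (gradient f x) : ℝ) * pLaplacian p f x ≤
      ∫ x, |pLaplacian p f x| * (‖x‖ * ‖gradient f x‖) := by
    refine integral_mono hAint ((hLcont.abs.mul hBcont).integrable_of_hasCompactSupport
      hGc.norm.mul_left.mul_left) fun x => ?_
    calc (inner ℝ x (gradient f x) : ℝ) * pLaplacian p f x
        ≤ |(inner ℝ x (gradient f x) : ℝ)| * |pLaplacian p f x| :=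
          (le_abs_self _).trans_eq (abs_mul _ _)
      _ ≤ (‖x‖ * ‖gradient f x‖) * |pLaplacian p f x| := by
          gcongr
          exact abs_real_inner_le_norm _ _
      _ = _ := mul_comm _ _
  have hHolder := integral_mul_le_Lp_mul_Lq_of_nonneg (μ := volume) hpq
    (f := fun x => |pLaplacian p f x|) (g := fun x => ‖x‖ * ‖gradient f x‖)
    (ae_of_all _ fun x => abs_nonneg _) (ae_of_all _ fun x => by positivity)
    (hLcont.abs.memLp_of_hasCompactSupport hLc.norm)
    (hBcont.memLp_of_hasCompactSupport hGc.norm.mul_left)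
  simp only [Real.mul_rpow (norm_nonneg _) (norm_nonneg _)] at hHolder
  have hnp : 0 < (n : ℝ) - p := sub_pos.2 hpn
  have hscale : ∫ x, ‖gradient f x‖ ^ p =
      p / (n - p) * (((n - p) / p) * ∫ x, ‖gradient f x‖ ^ p) := by
    field_simp
  rw [hscale, hpoh, mul_assoc]
  gcongr
  exact hCauchy.trans hHolder
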